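/- No surplus at the end of the horizon: assume x₀ ≥ 0 and that there exist an optimal policy u* ∈ S_u for J_σ and a constant η > 0 with η ≤ u*(t) ≤ α(t)/(2aβ(t)) − η for all t. Let x* be the trajectory of u*. Then there exists δ > 0 such that x*(t) ≤ 0 for all t ∈ [T−δ, T]; in particular x*(T) ≤ 0. -/

import Mathlib

open MeasureTheory Set
open scoped NNReal

noncomputable section

/-- Combined holding/shortage cost with holding factor `Ch` and shortage factor `Cs`. -/
def holding (Ch Cs x : ℝ) : ℝ := if x < 0 then Cs * x ^ 2 else Ch * x ^ 2

/-- Membership in the reduced policy space `S_u`. -/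
def memSu (T a : ℝ) (α β : ℝ → ℝ) (u : ℝ → ℝ) : Prop :=
  Measurable u ∧ ∀ t ∈ Icc (0 : ℝ) T, 0 ≤ u t ∧ u t ≤ α t / (2 * a * β t)

/-- Inventory trajectory under production rate `u` (with `γ(t) = 1 + aβ(t)`). -/
def trajU (a : ℝ) (α β : ℝ → ℝ) (x₀ : ℝ) (u : ℝ → ℝ) (t : ℝ) : ℝ :=
  x₀ + ∫ s in (0 : ℝ)..t, (u s * (1 + a * β s) - α s / 2)

/-- The objective `J_σ(u)` over the reduced policy space. -/
def JobjU (T a σ Ch Cs ChT CsT : ℝ) (α β : ℝ → ℝ) (x₀ : ℝ) (u : ℝ → ℝ) : ℝ :=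
  (∫ s in (0 : ℝ)..T,
    (-(a * u s ^ 2 * (1 + a * β s)) + α s ^ 2 / (4 * β s)
      - holding Ch Cs (trajU a α β x₀ u s)))
  - holding ChT CsT (trajU a α β x₀ u T)
  - σ * sSup (trajU a α β x₀ u '' Icc 0 T)

/-- Lowering the inventory by `d ≥ 0` raises the cost by at most `Cs * d * (d + 2 * |x|)`. -/
lemma holding_sub_le {Ch Cs x d : ℝ} (hCh : 0 < Ch) (hCs : 0 < Cs) (hd : 0 ≤ d) :
    holding Ch Cs (x - d) - holding Ch Cs x ≤ Cs * (d * (d + 2 * |x|)) := by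
  have hx := abs_nonneg x
  have hrhs : 0 ≤ Cs * (d * (d + 2 * |x|)) := by positivity
  unfold holding
  split_ifs with h₁ h₂ h₂
  · rw [abs_of_neg h₂]
    exact le_of_eq (by ring)
  · rw [not_lt] at h₂
    rw [abs_of_nonneg h₂]
    have h₃ : (x - d) ^ 2 ≤ d * (d + 2 * x) := by nlinarith [mul_nonneg hd h₂]
    nlinarith [mul_le_mul_of_nonneg_left h₃ hCs.le, mul_nonneg hCh.le (sq_nonneg x)]
  · linarith
  · rw [not_lt] at h₁ h₂
    have h₃ : (x - d) ^ 2 ≤ x ^ 2 := by nlinarith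
    nlinarith [mul_le_mul_of_nonneg_left h₃ hCh.le]

/-- Lowering a nonnegative inventory raises the cost at most quadratically. -/
lemma holding_sub_le_of_nonneg {Ch Cs x d : ℝ} (hCh : 0 < Ch) (hCs : 0 < Cs) (hx : 0 ≤ x)
    (hd : 0 ≤ d) : holding Ch Cs (x - d) - holding Ch Cs x ≤ Cs * d ^ 2 := by
  unfold holding
  rw [if_neg hx.not_gt]
  split_ifs with h₁
  · have h₃ : (x - d) ^ 2 ≤ d ^ 2 := by nlinarith
    nlinarith [mul_le_mul_of_nonneg_left h₃ hCs.le, mul_nonneg hCh.le (sq_nonneg x)]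
  · rw [not_lt] at h₁
    have h₃ : (x - d) ^ 2 ≤ x ^ 2 := by nlinarith
    nlinarith [mul_le_mul_of_nonneg_left h₃ hCh.le, mul_nonneg hCs.le (sq_nonneg d)]

lemma continuous_holding (Ch Cs : ℝ) : Continuous (holding Ch Cs) := by
  unfold holding
  refine Continuous.if ?_ (by fun_prop) (by fun_prop)
  intro x hx
  have h0 : x = 0 := by
    change x ∈ frontier (Iio (0 : ℝ)) at hx
    simpa using hx
  simp [h0]

lemma intervalIntegrable_mul_of_bounded {T B : ℝ} (hT : 0 ≤ T) {v g : ℝ → ℝ} (hv : Measurable v)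
    (hB : ∀ t ∈ Icc (0 : ℝ) T, |v t| ≤ B) (hg : ContinuousOn g (Icc 0 T)) :
    IntervalIntegrable (fun t => v t * g t) volume 0 T := by
  rw [intervalIntegrable_iff_integrableOn_Icc_of_le hT]
  have hvi : IntegrableOn v (Icc 0 T) :=
    Measure.integrableOn_of_bounded (by simp) hv.aestronglyMeasurable
      ((ae_restrict_iff' measurableSet_Icc).2 (Filter.Eventually.of_forall hB))
  exact hvi.mul_continuousOn hg isCompact_Icc

section Policy

variable {T a : ℝ} {α β u : ℝ → ℝ}

lemma exists_bound_of_memSu (ha : 0 < a) (hα : ContinuousOn α (Icc 0 T))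
    (hβ : ContinuousOn β (Icc 0 T)) (hβpos : ∀ t ∈ Icc (0 : ℝ) T, 0 < β t)
    (hu : memSu T a α β u) : ∃ B, ∀ t ∈ Icc (0 : ℝ) T, |u t| ≤ B := by
  have hc : ContinuousOn (fun t => α t / (2 * a * β t)) (Icc 0 T) :=
    hα.div (continuousOn_const.mul hβ) fun t ht => by have := hβpos t ht; positivity
  obtain ⟨B, hB⟩ := isCompact_Icc.exists_bound_of_continuousOn hc
  refine ⟨B, fun t ht => ?_⟩
  rw [abs_of_nonneg (hu.2 t ht).1]
  exact (hu.2 t ht).2.trans ((le_abs_self _).trans (hB t ht))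

lemma intervalIntegrable_rate (hT : 0 ≤ T) (ha : 0 < a) (hα : ContinuousOn α (Icc 0 T))
    (hβ : ContinuousOn β (Icc 0 T)) (hβpos : ∀ t ∈ Icc (0 : ℝ) T, 0 < β t)
    (hu : memSu T a α β u) :
    IntervalIntegrable (fun s => u s * (1 + a * β s) - α s / 2) volume 0 T := by
  obtain ⟨B, hB⟩ := exists_bound_of_memSu ha hα hβ hβpos hu
  refine (intervalIntegrable_mul_of_bounded hT hu.1 hB
    (continuousOn_const.add (continuousOn_const.mul hβ))).sub ?_
  exact ContinuousOn.intervalIntegrable_of_Icc hT (hα.div_const 2)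

lemma continuousOn_trajU (hT : 0 ≤ T) (ha : 0 < a) (hα : ContinuousOn α (Icc 0 T))
    (hβ : ContinuousOn β (Icc 0 T)) (hβpos : ∀ t ∈ Icc (0 : ℝ) T, 0 < β t)
    (hu : memSu T a α β u) (x₀ : ℝ) : ContinuousOn (trajU a α β x₀ u) (Icc 0 T) := by
  have h := intervalIntegral.continuousOn_primitive_interval'
    (intervalIntegrable_rate hT ha hα hβ hβpos hu) left_mem_uIcc
  rw [uIcc_of_le hT] at h
  exact continuousOn_const.add h

lemma intervalIntegrable_objective (hT : 0 ≤ T) (ha : 0 < a) (hα : ContinuousOn α (Icc 0 T))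
    (hβ : ContinuousOn β (Icc 0 T)) (hβpos : ∀ t ∈ Icc (0 : ℝ) T, 0 < β t)
    (hu : memSu T a α β u) (x₀ Ch Cs : ℝ) :
    IntervalIntegrable (fun s => -(a * u s ^ 2 * (1 + a * β s)) + α s ^ 2 / (4 * β s)
      - holding Ch Cs (trajU a α β x₀ u s)) volume 0 T := by
  obtain ⟨B, hB⟩ := exists_bound_of_memSu ha hα hβ hβpos hu
  have hB₂ : ∀ t ∈ Icc (0 : ℝ) T, |a * u t ^ 2| ≤ a * B ^ 2 := fun t ht => by
    rw [abs_mul, abs_pow, abs_of_pos ha]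
    have := hB t ht
    gcongr
  refine ((intervalIntegrable_mul_of_bounded hT ((hu.1.pow_const 2).const_mul a) hB₂
    (continuousOn_const.add (continuousOn_const.mul hβ))).neg.add ?_).sub ?_
  · refine ContinuousOn.intervalIntegrable_of_Icc hT
      ((hα.pow 2).div (continuousOn_const.mul hβ) fun t ht => ?_)
    have := hβpos t ht
    positivity
  · exact ContinuousOn.intervalIntegrable_of_Icc hT
      ((continuous_holding Ch Cs).comp_continuousOn
        (continuousOn_trajU hT ha hα hβ hβpos hu x₀))

end Policy

lemma integral_indicator_Ioi_const {T δ η : ℝ} (hδ : 0 ≤ δ) (hδT : δ ≤ T) :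
    ∫ s in (0 : ℝ)..T, (Ioi (T - δ)).indicator (fun _ => η) s = η * δ := by
  rw [intervalIntegral.integral_of_le (hδ.trans hδT),
    setIntegral_indicator measurableSet_Ioi]
  have : Ioc 0 T ∩ Ioi (T - δ) = Ioc (T - δ) T := by
    ext s
    simp only [mem_inter_iff, mem_Ioc, mem_Ioi]
    constructor
    · rintro ⟨⟨_, h₁⟩, h₂⟩
      exact ⟨h₂, h₁⟩
    · rintro ⟨h₁, h₂⟩
      exact ⟨⟨by linarith, h₂⟩, h₁⟩
  rw [this]
  simp [hδ, mul_comm]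

/-- Under an optimal policy bounded away from zero, the terminal inventory is negative: otherwise
lowering production by `η` on a short final interval improves the objective. -/
lemma trajU_end_neg {T a σ Ch Cs ChT CsT : ℝ} (hT : 0 < T) (ha : 0 < a) (hσ : 0 ≤ σ)
    (hCh : 0 < Ch) (hCs : 0 < Cs) (hChT : 0 < ChT) (hCsT : 0 < CsT) {α β : ℝ → ℝ}
    (hα : ContinuousOn α (Icc 0 T)) (hβ : ContinuousOn β (Icc 0 T))
    (hβpos : ∀ t ∈ Icc (0 : ℝ) T, 0 < β t) {x₀ : ℝ} {ustar : ℝ → ℝ}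
    (hmem : memSu T a α β ustar) {η : ℝ} (hη : 0 < η) (hηu : ∀ t ∈ Icc (0 : ℝ) T, η ≤ ustar t)
    (hopt : ∀ u : ℝ → ℝ, memSu T a α β u →
      JobjU T a σ Ch Cs ChT CsT α β x₀ u ≤ JobjU T a σ Ch Cs ChT CsT α β x₀ ustar) :
    trajU a α β x₀ ustar T < 0 := by
  by_contra! hxT
  have hγ : ContinuousOn (fun t => 1 + a * β t) (Icc 0 T) :=
    continuousOn_const.add (continuousOn_const.mul hβ)
  have hxc := continuousOn_trajU hT.le ha hα hβ hβpos hmem x₀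
  obtain ⟨M, hM⟩ := isCompact_Icc.exists_bound_of_continuousOn hxc
  obtain ⟨G, hG⟩ := isCompact_Icc.exists_bound_of_continuousOn hγ
  have h0T : (0 : ℝ) ∈ Icc 0 T := ⟨le_rfl, hT.le⟩
  have hTT : T ∈ Icc 0 T := ⟨hT.le, le_rfl⟩
  have hM0 : 0 ≤ M := (norm_nonneg _).trans (hM 0 h0T)
  have hγ1 : ∀ t ∈ Icc (0 : ℝ) T, 1 ≤ 1 + a * β t := fun t ht => by
    have := mul_pos ha (hβpos t ht)
    linarith
  have hγG : ∀ t ∈ Icc (0 : ℝ) T, 1 + a * β t ≤ G := fun t ht => (le_abs_self _).trans (hG t ht)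
  have hG0 : 0 < G := by linarith [hγ1 0 h0T, hγG 0 h0T]
  set L : ℝ := Cs * (G * η * T + 2 * M) with hL
  have hL0 : 0 < L := by positivity
  set K : ℝ := L * G + CsT * G ^ 2 * η with hK
  have hK0 : 0 < K := by positivity
  obtain ⟨δ, hδ, hδT, hδK⟩ : ∃ δ > 0, δ ≤ T ∧ K * δ < a * η := by
    refine ⟨min T (a * η / (2 * K)), by positivity, min_le_left _ _, ?_⟩
    calc K * min T (a * η / (2 * K)) ≤ K * (a * η / (2 * K)) := by
          gcongr
          exact min_le_right _ _
      _ = a * η / 2 := by field_simp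
      _ < a * η := half_lt_self (by positivity)
  set f : ℝ → ℝ := (Ioi (T - δ)).indicator fun _ => η with hf
  have hfm : Measurable f := measurable_const.indicator measurableSet_Ioi
  have hf0 : ∀ t, 0 ≤ f t := fun t => indicator_nonneg (fun _ _ => hη.le) t
  have hfη : ∀ t, f t ≤ η := fun t => indicator_le_self' (fun _ _ => hη.le) t
  have hfval : ∀ t, f t = 0 ∧ t ≤ T - δ ∨ f t = η := fun t => by
    by_cases h : t ∈ Ioi (T - δ)
    · exact Or.inr (indicator_of_mem h _)
    · exact Or.inl ⟨indicator_of_notMem h _, not_lt.1 h⟩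
  have hfi : ∀ {g : ℝ → ℝ}, ContinuousOn g (Icc 0 T) →
      IntervalIntegrable (fun s => f s * g s) volume 0 T := fun hg =>
    intervalIntegrable_mul_of_bounded hT.le hfm
      (fun t _ => (abs_of_nonneg (hf0 t)).trans_le (hfη t)) hg
  have hfint : ∫ s in (0 : ℝ)..T, f s = η * δ := integral_indicator_Ioi_const hδ.le hδT
  set u : ℝ → ℝ := fun t => ustar t - f t with hu
  have humem : memSu T a α β u := by
    refine ⟨hmem.1.sub hfm, fun t ht => ⟨?_, ?_⟩⟩
    · have := hηu t ht
      linarith [hfη t]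
    · linarith [hf0 t, (hmem.2 t ht).2]
  set D : ℝ → ℝ := fun t => ∫ s in (0 : ℝ)..t, f s * (1 + a * β s) with hD
  have hsub : ∀ {t}, t ∈ Icc (0 : ℝ) T → uIcc 0 t ⊆ uIcc 0 T := fun {t} ht => by
    rw [uIcc_of_le ht.1, uIcc_of_le hT.le]
    exact Icc_subset_Icc le_rfl ht.2
  have htraj : ∀ t ∈ Icc (0 : ℝ) T, trajU a α β x₀ u t = trajU a α β x₀ ustar t - D t := by
    intro t ht
    simp only [trajU, hD]
    rw [add_sub_assoc, ← intervalIntegral.integral_sub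
      ((intervalIntegrable_rate hT.le ha hα hβ hβpos hmem).mono_set (hsub ht))
      ((hfi hγ).mono_set (hsub ht))]
    congr 2
    ext s
    simp only [hu]
    ring
  have hfγ0 : ∀ t ∈ Icc (0 : ℝ) T, 0 ≤ f t * (1 + a * β t) := fun t ht =>
    mul_nonneg (hf0 t) (zero_le_one.trans (hγ1 t ht))
  have hD0 : ∀ t ∈ Icc (0 : ℝ) T, 0 ≤ D t := fun t ht =>
    intervalIntegral.integral_nonneg ht.1 fun s hs => hfγ0 s ⟨hs.1, hs.2.trans ht.2⟩
  have hDle : ∀ t ∈ Icc (0 : ℝ) T, D t ≤ G * η * δ := by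
    intro t ht
    calc D t ≤ ∫ s in (0 : ℝ)..T, f s * (1 + a * β s) := by
          refine intervalIntegral.integral_mono_interval le_rfl ht.1 ht.2 ?_ (hfi hγ)
          exact (ae_restrict_iff' measurableSet_Ioc).2
            (Filter.Eventually.of_forall fun s hs => hfγ0 s (Ioc_subset_Icc_self hs))
      _ ≤ ∫ s in (0 : ℝ)..T, f s * G :=
          intervalIntegral.integral_mono_on hT.le (hfi hγ) (hfi continuousOn_const)
            fun s hs => mul_le_mul_of_nonneg_left (hγG s hs) (hf0 s)
      _ = G * η * δ := by
          rw [intervalIntegral.integral_mul_const, hfint]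
          ring
  have hDf : ∀ t ∈ Icc (0 : ℝ) T, D t ≤ G * δ * f t := by
    intro t ht
    rcases hfval t with ⟨h, htδ⟩ | h
    · have hDt : D t = ∫ _ in (0 : ℝ)..t, (0 : ℝ) := by
        refine intervalIntegral.integral_congr fun s hs => ?_
        rw [uIcc_of_le ht.1] at hs
        have hs' : f s = 0 := indicator_of_notMem (not_lt.2 (hs.2.trans htδ)) _
        simp [hs']
      simp [hDt, h]
    · rw [h]
      linarith [hDle t ht]
  have hrun : ∀ t ∈ Icc (0 : ℝ) T, f t * (a * η - L * G * δ) ≤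
      (-(a * u t ^ 2 * (1 + a * β t)) + α t ^ 2 / (4 * β t)
        - holding Ch Cs (trajU a α β x₀ u t)) -
      (-(a * ustar t ^ 2 * (1 + a * β t)) + α t ^ 2 / (4 * β t)
        - holding Ch Cs (trajU a α β x₀ ustar t)) := by
    intro t ht
    have hhold : holding Ch Cs (trajU a α β x₀ u t) - holding Ch Cs (trajU a α β x₀ ustar t) ≤
        f t * (L * G * δ) := by
      rw [htraj t ht]
      have h₁ : D t + 2 * |trajU a α β x₀ ustar t| ≤ G * η * T + 2 * M := by
        have h₂ : |trajU a α β x₀ ustar t| ≤ M := hM t ht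
        have h₃ : G * η * δ ≤ G * η * T := by gcongr
        linarith [hDle t ht]
      calc _ ≤ Cs * (D t * (D t + 2 * |trajU a α β x₀ ustar t|)) :=
            holding_sub_le hCh hCs (hD0 t ht)
        _ ≤ Cs * (G * δ * f t * (G * η * T + 2 * M)) := by
            have h₀ := hD0 t ht
            have h₂ := hDf t ht
            have h₃ := hf0 t
            gcongr
        _ = f t * (L * G * δ) := by
            rw [hL]
            ring
    have hsq : f t * η ≤ ustar t ^ 2 - u t ^ 2 := by
      simp only [hu]
      nlinarith [hf0 t, hfη t, hηu t ht]
    have hsq0 : 0 ≤ f t * η := mul_nonneg (hf0 t) hη.le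
    have hprod : f t * η ≤ (ustar t ^ 2 - u t ^ 2) * (1 + a * β t) :=
      hsq.trans (le_mul_of_one_le_right (hsq0.trans hsq) (hγ1 t ht))
    nlinarith [mul_le_mul_of_nonneg_left hprod ha.le]
  have hIu := intervalIntegrable_objective hT.le ha hα hβ hβpos humem x₀ Ch Cs
  have hIs := intervalIntegrable_objective hT.le ha hα hβ hβpos hmem x₀ Ch Cs
  have hgain := intervalIntegral.integral_mono_on hT.le (hfi continuousOn_const) (hIu.sub hIs) hrun
  rw [intervalIntegral.integral_mul_const, hfint, intervalIntegral.integral_sub hIu hIs] at hgain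
  have hterm : holding ChT CsT (trajU a α β x₀ u T) - holding ChT CsT (trajU a α β x₀ ustar T) ≤
      CsT * (G * η * δ) ^ 2 := by
    rw [htraj T hTT]
    refine (holding_sub_le_of_nonneg hChT hCsT hxT (hD0 T hTT)).trans ?_
    have h₀ := hD0 T hTT
    have h₁ := hDle T hTT
    gcongr
  have hsup : σ * sSup (trajU a α β x₀ u '' Icc 0 T) ≤
      σ * sSup (trajU a α β x₀ ustar '' Icc 0 T) := by
    refine mul_le_mul_of_nonneg_left ?_ hσ
    refine csSup_le ⟨_, mem_image_of_mem _ h0T⟩ ?_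
    rintro _ ⟨t, ht, rfl⟩
    refine le_csSup_of_le (isCompact_Icc.bddAbove_image hxc) (mem_image_of_mem _ ht) ?_
    rw [htraj t ht]
    linarith [hD0 t ht]
  have hJ := hopt u humem
  unfold JobjU at hJ
  have hpos : 0 < η * δ * (a * η - K * δ) := mul_pos (mul_pos hη hδ) (sub_pos.2 hδK)
  have hexp : η * δ * (a * η - K * δ) =
      η * δ * (a * η - L * G * δ) - CsT * (G * η * δ) ^ 2 := by
    rw [hK]
    ring
  linarith

/-- no surplus at the end of the horizon: the optimal inventory
trajectory is nonpositive on some final interval `[T-δ, T]`; in particular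
`x*(T) ≤ 0`. -/
theorem optimal_inventory_nonpositive_at_end
    (T a σ Ch Cs ChT CsT : ℝ)
    (hT : 0 < T) (ha : 0 < a) (hσ : 0 ≤ σ)
    (hCh : 0 < Ch) (hCs : 0 < Cs) (hChT : 0 < ChT) (hCsT : 0 < CsT)
    (α β : ℝ → ℝ)
    (hαLip : ∃ K : ℝ≥0, LipschitzOnWith K α (Icc 0 T))
    (hβLip : ∃ K : ℝ≥0, LipschitzOnWith K β (Icc 0 T))
    (hα : ∀ t ∈ Icc (0 : ℝ) T, 0 < α t) (hβ : ∀ t ∈ Icc (0 : ℝ) T, 0 < β t)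
    (x₀ : ℝ) (hx₀ : 0 ≤ x₀)
    (ustar : ℝ → ℝ) (hmem : memSu T a α β ustar)
    (hint : ∃ η > (0 : ℝ), ∀ t ∈ Icc (0 : ℝ) T,
      η ≤ ustar t ∧ ustar t ≤ α t / (2 * a * β t) - η)
    (hopt : ∀ u : ℝ → ℝ, memSu T a α β u →
      JobjU T a σ Ch Cs ChT CsT α β x₀ u ≤ JobjU T a σ Ch Cs ChT CsT α β x₀ ustar) :
    (∃ δ > (0 : ℝ), ∀ t ∈ Icc (T - δ) T, trajU a α β x₀ ustar t ≤ 0) ∧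
    trajU a α β x₀ ustar T ≤ 0 := by
  obtain ⟨Kα, hKα⟩ := hαLip
  obtain ⟨Kβ, hKβ⟩ := hβLip
  obtain ⟨η, hη, hηu⟩ := hint
  have hneg := trajU_end_neg hT ha hσ hCh hCs hChT hCsT hKα.continuousOn hKβ.continuousOn hβ
    hmem hη (fun t ht => (hηu t ht).1) hopt
  refine ⟨?_, hneg.le⟩
  have hxc := continuousOn_trajU hT.le ha hKα.continuousOn hKβ.continuousOn hβ hmem x₀
  have hev := (hxc T ⟨hT.le, le_rfl⟩).eventually_lt_const hneg
  obtain ⟨ε, hε, hball⟩ := Metric.mem_nhdsWithin_iff.1 hev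
  refine ⟨min T (ε / 2), by positivity, fun t ht => le_of_lt (hball ⟨?_, ?_, ht.2⟩)⟩
  · rw [Metric.mem_ball, Real.dist_eq, abs_sub_lt_iff]
    constructor <;> linarith [ht.1, ht.2, min_le_right T (ε / 2)]
  · linarith [ht.1, min_le_left T (ε / 2)]
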